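/- There exist positive constants c₁, c₂ (depending only on ρ) and C, c > 0 such that for all sufficiently small ε > 0 and every v ∈ H¹(I): (i) if θ₂(v) ≤ c₂, then ∫_I ( (ε/2)v′(z)² + (1/(2ε))(v(z)²−1)² ) dz − c₀ ≥ −C·e^{−c/ε}; and (ii) if in addition θ₁(v) ≤ c₁, then ∫_I ( √ε·v′(z) − (1 − v(z)²)/√ε )² dz ≤ C·[ ∫_I ( (ε/2)v′(z)² + (1/(2ε))(v(z)²−1)² ) dz − c₀ ] + C·e^{−c/ε} ≤ C·θ₁(v) + C·e^{−c/ε}. -/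

import Mathlib

open MeasureTheory Real

/-- `θ₁(v) := ∫_I (1+z²)((ε/2)v′² + (1/(2ε))(v²−1)²) dz − c₀`, with `c₀ = 4/3`. -/
noncomputable def theta1 (ρ ε : ℝ) (v : ℝ → ℝ) : ℝ :=
  (∫ z in Set.Ioo (-ρ) ρ,
      (1 + z ^ 2) * ((ε / 2) * (deriv v z) ^ 2 + (1 / (2 * ε)) * ((v z) ^ 2 - 1) ^ 2))
    - 4 / 3

/-- `θ₂(v) := ∫_I |z|·|v(z) − sign(z)|² dz`. -/
noncomputable def theta2 (ρ : ℝ) (v : ℝ → ℝ) : ℝ :=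
  ∫ z in Set.Ioo (-ρ) ρ, |z| * (v z - Real.sign z) ^ 2

/-- The energy density. -/
noncomputable def edens (ε : ℝ) (v : ℝ → ℝ) (z : ℝ) : ℝ :=
  (ε / 2) * (deriv v z) ^ 2 + (1 / (2 * ε)) * ((v z) ^ 2 - 1) ^ 2

/-- The discrepancy density. -/
noncomputable def ddens (ε : ℝ) (v : ℝ → ℝ) (z : ℝ) : ℝ :=
  (Real.sqrt ε * deriv v z - (1 - (v z) ^ 2) / Real.sqrt ε) ^ 2

/-- The Modica-Mortola primitive. -/
noncomputable def phi (s : ℝ) : ℝ := s - s ^ 3 / 3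

lemma edens_nonneg {ε : ℝ} (hε : 0 < ε) (v : ℝ → ℝ) (z : ℝ) : 0 ≤ edens ε v z := by
  unfold edens; positivity

lemma ddens_eq {ε : ℝ} (hε : 0 < ε) (v : ℝ → ℝ) (z : ℝ) :
    ddens ε v z = 2 * edens ε v z - 2 * ((1 - v z ^ 2) * deriv v z) := by
  unfold ddens edens
  have hs : Real.sqrt ε ≠ 0 := (Real.sqrt_pos.2 hε).ne'
  have h2 : Real.sqrt ε ^ 2 = ε := Real.sq_sqrt hε.le
  have : (Real.sqrt ε * deriv v z - (1 - (v z) ^ 2) / Real.sqrt ε) ^ 2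
      = Real.sqrt ε ^ 2 * deriv v z ^ 2 - 2 * ((1 - v z ^ 2) * deriv v z)
        + (1 - v z ^ 2) ^ 2 / Real.sqrt ε ^ 2 := by
    field_simp
    ring
  rw [this, h2]
  field_simp
  ring

lemma young {ε : ℝ} (hε : 0 < ε) (v : ℝ → ℝ) (z : ℝ) :
    |(1 - v z ^ 2) * deriv v z| ≤ edens ε v z := by
  unfold edens
  have key : ∀ s p : ℝ, (1 - s ^ 2) * p ≤ (ε / 2) * p ^ 2 + (1 / (2 * ε)) * (s ^ 2 - 1) ^ 2 := by
    intro s p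
    have : (ε / 2) * p ^ 2 + (1 / (2 * ε)) * (s ^ 2 - 1) ^ 2 - (1 - s ^ 2) * p
        = (1 / (2 * ε)) * (ε * p - (1 - s ^ 2)) ^ 2 := by
      field_simp; ring
    have h : 0 ≤ (1 / (2 * ε)) * (ε * p - (1 - s ^ 2)) ^ 2 := by positivity
    linarith
  rw [abs_le]
  constructor
  · have := key (v z) (-deriv v z)
    rw [neg_sq] at this
    linarith
  · exact key _ _

/-- Pointwise calibration inequality. -/
lemma calib {ε s u p : ℝ} (hε : 0 < ε) (hs : 0 ≤ s) (hu : 0 ≤ u) (hu' : u ≤ 3 / 2) :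
    (3 / 8 / ε * u) * (2 / 3 - phi s) + (1 - u) * ((1 - s ^ 2) * p)
      ≤ (ε / 2) * p ^ 2 + (1 / (2 * ε)) * (s ^ 2 - 1) ^ 2 := by
  unfold phi
  have h1 : (ε / 2) * p ^ 2 + (1 / (2 * ε)) * (s ^ 2 - 1) ^ 2
      - ((3 / 8 / ε * u) * (2 / 3 - (s - s ^ 3 / 3)) + (1 - u) * ((1 - s ^ 2) * p))
      = (1 / (2 * ε)) * ((ε * p - (1 - u) * (1 - s ^ 2)) ^ 2 +
        (u * (3 / 2 - u) * (1 - s ^ 2) ^ 2 + u * (1 - s) ^ 2 * (s * (3 + 2 * s)) / 4)) := by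
    field_simp; ring
  have h2 : 0 ≤ (1 / (2 * ε)) * ((ε * p - (1 - u) * (1 - s ^ 2)) ^ 2 +
        (u * (3 / 2 - u) * (1 - s ^ 2) ^ 2 + u * (1 - s) ^ 2 * (s * (3 + 2 * s)) / 4)) := by
    have : 0 ≤ 3 / 2 - u := by linarith
    positivity
  linarith

lemma phi_big {s : ℝ} (h : (s - 1) ^ 2 ≤ 1 / 16) : 59 / 100 ≤ phi s := by
  unfold phi
  have h1 : 3 / 4 ≤ s := by nlinarith
  have h2 : s ≤ 5 / 4 := by nlinarith
  nlinarith [mul_nonneg (sub_nonneg.2 h1) (sub_nonneg.2 h2)]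

lemma phi_neg (s : ℝ) : phi (-s) = - phi s := by unfold phi; ring

lemma hasDerivAt_phi {v : ℝ → ℝ} {z : ℝ} (h : DifferentiableAt ℝ v z) :
    HasDerivAt (fun z => phi (v z)) ((1 - v z ^ 2) * deriv v z) z := by
  unfold phi
  have := h.hasDerivAt.sub ((h.hasDerivAt.pow 3).div_const 3)
  refine HasDerivAt.congr_deriv this ?_
  push_cast
  ring

section
variable {ρ : ℝ} {v : ℝ → ℝ}

lemma diffAt (hd : DifferentiableOn ℝ v (Set.Ioo (-ρ) ρ)) {z : ℝ} (h1 : -ρ < z) (h2 : z < ρ) :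
    DifferentiableAt ℝ v z :=
  (hd z ⟨h1, h2⟩).differentiableAt (Ioo_mem_nhds h1 h2)

lemma int_dsq (hd : DifferentiableOn ℝ v (Set.Ioo (-ρ) ρ))
    (hi : IntegrableOn (fun z => (v z) ^ 2 + (deriv v z) ^ 2) (Set.Ioo (-ρ) ρ)) :
    IntegrableOn (fun z => (deriv v z) ^ 2) (Set.Ioo (-ρ) ρ) := by
  refine Integrable.mono' hi ((measurable_deriv v).pow_const 2).aestronglyMeasurable ?_
  refine Filter.Eventually.of_forall fun z => ?_
  rw [Real.norm_eq_abs, abs_of_nonneg (sq_nonneg _)]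
  nlinarith [sq_nonneg (v z)]

lemma int_d (hd : DifferentiableOn ℝ v (Set.Ioo (-ρ) ρ))
    (hi : IntegrableOn (fun z => (v z) ^ 2 + (deriv v z) ^ 2) (Set.Ioo (-ρ) ρ)) :
    IntegrableOn (fun z => |deriv v z|) (Set.Ioo (-ρ) ρ) := by
  have h1 : IntegrableOn (fun _ : ℝ => (1 : ℝ)) (Set.Ioo (-ρ) ρ) :=
    integrableOn_const (by simp)
  refine Integrable.mono' (h1.add (int_dsq hd hi))
    (measurable_deriv v).abs.aestronglyMeasurable ?_
  refine Filter.Eventually.of_forall fun z => ?_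
  simp only [Pi.add_apply]
  rw [Real.norm_eq_abs, abs_abs]
  nlinarith [sq_nonneg (|deriv v z| - 1), sq_abs (deriv v z)]

lemma II {f : ℝ → ℝ} (hf : IntegrableOn f (Set.Ioo (-ρ) ρ)) {x y : ℝ} (hx : -ρ < x) (hxy : x ≤ y)
    (hy : y < ρ) : IntegrableOn f (Set.Icc x y) :=
  hf.mono_set (fun _ hz => ⟨hx.trans_le hz.1, hz.2.trans_lt hy⟩)

lemma int_le {f : ℝ → ℝ} (hf : IntegrableOn f (Set.Ioo (-ρ) ρ)) (h0 : ∀ z, 0 ≤ f z)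
    {x y : ℝ} (hx : -ρ < x) (hxy : x ≤ y) (hy : y < ρ) :
    ∫ z in x..y, f z ≤ ∫ z in Set.Ioo (-ρ) ρ, f z := by
  rw [intervalIntegral.integral_of_le hxy]
  refine setIntegral_mono_set hf (Filter.Eventually.of_forall h0) ?_
  exact Filter.Eventually.of_forall fun z hz => ⟨hx.trans hz.1, hz.2.trans_lt hy⟩

lemma ivi {f : ℝ → ℝ} (hf : IntegrableOn f (Set.Ioo (-ρ) ρ)) {x y : ℝ} (hx : -ρ < x) (hxy : x ≤ y)
    (hy : y < ρ) : IntervalIntegrable f volume x y := by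
  rw [intervalIntegrable_iff_integrableOn_Icc_of_le hxy]
  exact II hf hx hxy hy

/-- Integration of a derivative bound. -/
lemma ftc_le {g g' φ : ℝ → ℝ} {x y : ℝ} (hxy : x ≤ y)
    (hg : ∀ z ∈ Set.Icc x y, HasDerivAt g (g' z) z)
    (hφ : IntegrableOn φ (Set.Icc x y)) (hle : ∀ z ∈ Set.Ioo x y, g' z ≤ φ z) :
    g y - g x ≤ ∫ z in x..y, φ z :=
  intervalIntegral.sub_le_integral_of_hasDeriv_right_of_le hxy
    (fun z hz => (hg z hz).continuousAt.continuousWithinAt)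
    (fun z hz => (hg z (Set.Ioo_subset_Icc_self hz)).hasDerivWithinAt) hφ hle

lemma bdd (hρ : 0 < ρ) (hd : DifferentiableOn ℝ v (Set.Ioo (-ρ) ρ))
    (hi : IntegrableOn (fun z => (v z) ^ 2 + (deriv v z) ^ 2) (Set.Ioo (-ρ) ρ)) :
    ∃ M, 0 ≤ M ∧ ∀ z ∈ Set.Ioo (-ρ) ρ, |v z| ≤ M := by
  have hI := int_d hd hi
  have hosc : ∀ x y, -ρ < x → x ≤ y → y < ρ →
      |v y - v x| ≤ ∫ z in Set.Ioo (-ρ) ρ, |deriv v z| := by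
    intro x y hx hxy hy
    have hD : ∀ z ∈ Set.Icc x y, HasDerivAt v (deriv v z) z := fun z hz =>
      (diffAt hd (hx.trans_le hz.1) (hz.2.trans_lt hy)).hasDerivAt
    have h1 := ftc_le hxy hD (II hI hx hxy hy) (fun z _ => le_abs_self _)
    have h2 := ftc_le (g := fun z => - v z) hxy (fun z hz => (hD z hz).neg) (II hI hx hxy hy)
      (fun z _ => neg_le_abs _)
    have h3 := int_le hI (fun z => abs_nonneg _) hx hxy hy
    rw [abs_le]; constructor <;> linarith
  refine ⟨|v 0| + ∫ z in Set.Ioo (-ρ) ρ, |deriv v z|, ?_, ?_⟩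
  · have : 0 ≤ ∫ z in Set.Ioo (-ρ) ρ, |deriv v z| := integral_nonneg fun z => abs_nonneg _
    positivity
  · intro z hz
    rcases le_total 0 z with h | h
    · have := hosc 0 z (by linarith) h hz.2
      rw [abs_le] at this
      rw [abs_le]; constructor <;> linarith [le_abs_self (v 0), neg_abs_le (v 0)]
    · have := hosc z 0 hz.1 h hρ
      rw [abs_le] at this
      rw [abs_le]; constructor <;> linarith [le_abs_self (v 0), neg_abs_le (v 0)]

lemma aesm (hd : DifferentiableOn ℝ v (Set.Ioo (-ρ) ρ)) :
    AEStronglyMeasurable v (volume.restrict (Set.Ioo (-ρ) ρ)) :=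
  hd.continuousOn.aestronglyMeasurable measurableSet_Ioo

lemma int_e (hρ : 0 < ρ) (hd : DifferentiableOn ℝ v (Set.Ioo (-ρ) ρ))
    (hi : IntegrableOn (fun z => (v z) ^ 2 + (deriv v z) ^ 2) (Set.Ioo (-ρ) ρ)) (ε : ℝ) :
    IntegrableOn (edens ε v) (Set.Ioo (-ρ) ρ) := by
  obtain ⟨M, hM, hb⟩ := bdd hρ hd hi
  unfold edens
  refine ((int_dsq hd hi).const_mul (ε / 2)).add (Integrable.const_mul ?_ _)
  refine Integrable.of_bound
    ((((aesm hd).pow 2).sub aestronglyMeasurable_const).pow 2) ((M ^ 2 + 1) ^ 2) ?_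
  refine (ae_restrict_iff' measurableSet_Ioo).2 (Filter.Eventually.of_forall fun z hz => ?_)
  have := hb z hz
  rw [Real.norm_eq_abs, abs_pow]
  have h2 : |v z ^ 2 - 1| ≤ M ^ 2 + 1 := by
    have : v z ^ 2 ≤ M ^ 2 := by
      rw [← sq_abs (v z)]; gcongr
    rw [abs_le]; constructor <;> nlinarith [sq_nonneg (v z), sq_nonneg M]
  gcongr

lemma int_cross (hρ : 0 < ρ) (hd : DifferentiableOn ℝ v (Set.Ioo (-ρ) ρ))
    (hi : IntegrableOn (fun z => (v z) ^ 2 + (deriv v z) ^ 2) (Set.Ioo (-ρ) ρ)) {ε : ℝ}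
    (hε : 0 < ε) :
    IntegrableOn (fun z => (1 - v z ^ 2) * deriv v z) (Set.Ioo (-ρ) ρ) := by
  refine Integrable.mono' (int_e hρ hd hi ε)
    ((aestronglyMeasurable_const.sub ((aesm hd).pow 2)).mul
      (measurable_deriv v).aestronglyMeasurable) ?_
  exact Filter.Eventually.of_forall fun z => young hε v z

lemma int_D (hρ : 0 < ρ) (hd : DifferentiableOn ℝ v (Set.Ioo (-ρ) ρ))
    (hi : IntegrableOn (fun z => (v z) ^ 2 + (deriv v z) ^ 2) (Set.Ioo (-ρ) ρ)) {ε : ℝ}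
    (hε : 0 < ε) :
    IntegrableOn (ddens ε v) (Set.Ioo (-ρ) ρ) := by
  have : ddens ε v = fun z => 2 * edens ε v z - 2 * ((1 - v z ^ 2) * deriv v z) :=
    funext fun z => ddens_eq hε v z
  rw [this]
  exact ((int_e hρ hd hi ε).const_mul 2).sub ((int_cross hρ hd hi hε).const_mul 2)

lemma int_t2 (hρ : 0 < ρ) (hd : DifferentiableOn ℝ v (Set.Ioo (-ρ) ρ))
    (hi : IntegrableOn (fun z => (v z) ^ 2 + (deriv v z) ^ 2) (Set.Ioo (-ρ) ρ)) :
    IntegrableOn (fun z => |z| * (v z - Real.sign z) ^ 2) (Set.Ioo (-ρ) ρ) := by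
  obtain ⟨M, hM, hb⟩ := bdd hρ hd hi
  have hms : Measurable Real.sign := by
    unfold Real.sign
    exact Measurable.ite measurableSet_Iio measurable_const
      (Measurable.ite measurableSet_Ioi measurable_const measurable_const)
  refine Integrable.of_bound
    (measurable_id.abs.aestronglyMeasurable.mul
      (((aesm hd).sub hms.aestronglyMeasurable).pow 2)) (ρ * (M + 1) ^ 2) ?_
  refine (ae_restrict_iff' measurableSet_Ioo).2 (Filter.Eventually.of_forall fun z hz => ?_)
  have h1 := hb z hz
  have hz' : |z| ≤ ρ := abs_le.2 ⟨hz.1.le, hz.2.le⟩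
  have hs : |Real.sign z| ≤ 1 := by
    rcases Real.sign_apply_eq z with h | h | h <;> rw [h] <;> norm_num
  have h2 : |v z - Real.sign z| ≤ M + 1 := (abs_sub _ _).trans (by linarith)
  rw [Real.norm_eq_abs, abs_mul, abs_abs, abs_pow]
  gcongr

lemma phi_le (hρ : 0 < ρ) (hd : DifferentiableOn ℝ v (Set.Ioo (-ρ) ρ))
    (hi : IntegrableOn (fun z => (v z) ^ 2 + (deriv v z) ^ 2) (Set.Ioo (-ρ) ρ)) {ε : ℝ}
    (hε : 0 < ε) {x y : ℝ} (hx : -ρ < x) (hxy : x ≤ y) (hy : y < ρ) :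
    |phi (v y) - phi (v x)| ≤ ∫ z in x..y, edens ε v z := by
  have hD : ∀ z ∈ Set.Icc x y, HasDerivAt (fun z => phi (v z)) ((1 - v z ^ 2) * deriv v z) z :=
    fun z hz => hasDerivAt_phi (diffAt hd (hx.trans_le hz.1) (hz.2.trans_lt hy))
  have hI := II (int_e hρ hd hi ε) hx hxy hy
  have h1 := ftc_le hxy hD hI (fun z _ => (le_abs_self _).trans (young hε v z))
  have h2 := ftc_le (g := fun z => - phi (v z)) hxy (fun z hz => (hD z hz).neg) hI
      (fun z _ => (neg_le_abs _).trans (young hε v z))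
  rw [abs_le]; constructor <;> linarith

/-- Existence of good points from smallness of `theta2`. -/
lemma good_points (hρ : 0 < ρ) (hd : DifferentiableOn ℝ v (Set.Ioo (-ρ) ρ))
    (hi : IntegrableOn (fun z => (v z) ^ 2 + (deriv v z) ^ 2) (Set.Ioo (-ρ) ρ))
    (ht : theta2 ρ v ≤ ρ ^ 2 / 512) :
    (∃ p ∈ Set.Ioo (ρ / 4) (ρ / 2), (v p - 1) ^ 2 ≤ 1 / 16) ∧
    (∃ n ∈ Set.Ioo (-(ρ / 2)) (-(ρ / 4)), (- v n - 1) ^ 2 ≤ 1 / 16) := by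
  have hI := int_t2 hρ hd hi
  have key : ∀ a : ℝ, -ρ ≤ a → a + ρ / 4 ≤ ρ →
      (∀ z ∈ Set.Ioo a (a + ρ / 4), ρ / 64 ≤ |z| * (v z - Real.sign z) ^ 2) → False := by
    intro a ha1 ha2 h
    have hsub : Set.Ioo a (a + ρ / 4) ⊆ Set.Ioo (-ρ) ρ := Set.Ioo_subset_Ioo ha1 ha2
    have h1 : ∫ z in Set.Ioo a (a + ρ / 4), |z| * (v z - Real.sign z) ^ 2 ≤ theta2 ρ v :=
      setIntegral_mono_set hI (Filter.Eventually.of_forall fun z => by positivity)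
        (Filter.Eventually.of_forall hsub)
    have h2 : ∫ z in Set.Ioo a (a + ρ / 4), ρ / 64
        ≤ ∫ z in Set.Ioo a (a + ρ / 4), |z| * (v z - Real.sign z) ^ 2 :=
      setIntegral_mono_on (integrableOn_const (by simp)) (hI.mono_set hsub) measurableSet_Ioo h
    rw [setIntegral_const] at h2
    simp [Measure.real, ENNReal.toReal_ofReal (show 0 ≤ ρ / 4 by positivity)] at h2
    nlinarith [sq_pos_of_pos hρ]
  constructor
  · by_contra! hcon
    refine key (ρ / 4) (by linarith) (by linarith) fun z hz => ?_
    have hz2 := hcon z ⟨hz.1, by linarith [hz.2]⟩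
    have hz0 : 0 < z := by linarith [hz.1]
    rw [Real.sign_of_pos hz0, abs_of_pos hz0]
    nlinarith [hz.1]
  · by_contra! hcon
    refine key (-(ρ / 2)) (by linarith) (by linarith) fun z hz => ?_
    have hz2 := hcon z ⟨hz.1, by linarith [hz.2]⟩
    have hz0 : z < 0 := by linarith [hz.2]
    rw [Real.sign_of_neg hz0, abs_of_neg hz0]
    nlinarith [hz.2]

/-- Calibration on the right half. -/
lemma right_half (hρ : 0 < ρ) (hd : DifferentiableOn ℝ v (Set.Ioo (-ρ) ρ))
    (hi : IntegrableOn (fun z => (v z) ^ 2 + (deriv v z) ^ 2) (Set.Ioo (-ρ) ρ)) {ε : ℝ}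
    (hε : 0 < ε) {b r : ℝ} (hb : -ρ < b) (hbr : b ≤ r) (hr : r < ρ) (hb0 : v b = 0)
    (hv : ∀ z ∈ Set.Ioo b r, 0 ≤ v z) :
    2 / 3 - Real.exp (-(3 / 8 / ε) * (r - b)) + 1 / 2 * (2 / 3 - phi (v r))
      ≤ ∫ z in b..r, edens ε v z := by
  have hD : ∀ z ∈ Set.Icc b r, HasDerivAt
      (fun z => -((1 - 3 / 2 * Real.exp (-(3 / 8 / ε) * (r - z))) * (2 / 3 - phi (v z))))
      ((3 / 8 / ε * (3 / 2 * Real.exp (-(3 / 8 / ε) * (r - z)))) * (2 / 3 - phi (v z)) +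
        (1 - 3 / 2 * Real.exp (-(3 / 8 / ε) * (r - z))) * ((1 - v z ^ 2) * deriv v z)) z := by
    intro z hz
    have h1 := hasDerivAt_phi (diffAt hd (hb.trans_le hz.1) (hz.2.trans_lt hr))
    have h2 : HasDerivAt (fun z => Real.exp (-(3 / 8 / ε) * (r - z))) _ z :=
      (((hasDerivAt_id z).const_sub r).const_mul (-(3 / 8 / ε))).exp
    have h3 := (((h2.const_mul (3 / 2)).const_sub 1).mul (h1.const_sub (2 / 3))).neg
    refine HasDerivAt.congr_deriv h3 ?_
    simp only [id]
    ring
  have h := ftc_le hbr hD (II (int_e hρ hd hi ε) hb hbr hr) (fun z hz => by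
    refine calib hε (hv z hz) (by positivity) ?_
    have : Real.exp (-(3 / 8 / ε) * (r - z)) ≤ 1 := by
      rw [Real.exp_le_one_iff]
      have : 0 ≤ (3 / 8 / ε) * (r - z) := mul_nonneg (by positivity) (by linarith [hz.2])
      linarith
    linarith)
  have e0 : phi 0 = 0 := by simp [phi]
  simp only [hb0, e0, sub_self, mul_zero, Real.exp_zero] at h
  linarith

/-- Calibration on the left half. -/
lemma left_half (hρ : 0 < ρ) (hd : DifferentiableOn ℝ v (Set.Ioo (-ρ) ρ))
    (hi : IntegrableOn (fun z => (v z) ^ 2 + (deriv v z) ^ 2) (Set.Ioo (-ρ) ρ)) {ε : ℝ}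
    (hε : 0 < ε) {a r : ℝ} (ha : a < ρ) (har : -r ≤ a) (hr : r < ρ) (ha0 : v a = 0)
    (hv : ∀ z ∈ Set.Ioo (-r) a, v z ≤ 0) :
    2 / 3 - Real.exp (-(3 / 8 / ε) * (r + a)) + 1 / 2 * (2 / 3 + phi (v (-r)))
      ≤ ∫ z in (-r)..a, edens ε v z := by
  have hD : ∀ z ∈ Set.Icc (-r) a, HasDerivAt
      (fun z => ((1 - 3 / 2 * Real.exp (-(3 / 8 / ε) * (r + z))) * (2 / 3 + phi (v z))))
      ((3 / 8 / ε * (3 / 2 * Real.exp (-(3 / 8 / ε) * (r + z)))) * (2 / 3 + phi (v z)) +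
        (1 - 3 / 2 * Real.exp (-(3 / 8 / ε) * (r + z))) * ((1 - v z ^ 2) * deriv v z)) z := by
    intro z hz
    have h1 := hasDerivAt_phi (diffAt hd (by linarith [hz.1]) (hz.2.trans_lt ha))
    have h2 : HasDerivAt (fun z => Real.exp (-(3 / 8 / ε) * (r + z))) _ z :=
      (((hasDerivAt_id z).const_add r).const_mul (-(3 / 8 / ε))).exp
    have h3 := (((h2.const_mul (3 / 2)).const_sub 1).mul (h1.const_add (2 / 3)))
    refine HasDerivAt.congr_deriv h3 ?_
    simp only [id]
    ring
  have h := ftc_le har hD (II (int_e hρ hd hi ε) (by linarith) har ha) (fun z hz => by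
    have hc := calib (s := - v z) (p := deriv v z)
      (u := 3 / 2 * Real.exp (-(3 / 8 / ε) * (r + z))) hε (by linarith [hv z hz])
      (by positivity) (by
        have : Real.exp (-(3 / 8 / ε) * (r + z)) ≤ 1 := by
          rw [Real.exp_le_one_iff]
          have : 0 ≤ (3 / 8 / ε) * (r + z) := mul_nonneg (by positivity) (by linarith [hz.1])
          linarith
        linarith)
    rw [phi_neg, neg_sq, sub_neg_eq_add] at hc
    exact hc)
  have e0 : phi 0 = 0 := by simp [phi]
  simp only [ha0, e0, add_neg_cancel, mul_zero, Real.exp_zero] at h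
  linarith

/-- Dichotomy: either the energy is large, or the estimate holds. -/
lemma dichotomy (hρ : 0 < ρ) (hd : DifferentiableOn ℝ v (Set.Ioo (-ρ) ρ))
    (hi : IntegrableOn (fun z => (v z) ^ 2 + (deriv v z) ^ 2) (Set.Ioo (-ρ) ρ)) {ε : ℝ}
    (hε : 0 < ε) (hε' : ε < 3 / 64 * ρ) (ht : theta2 ρ v ≤ ρ ^ 2 / 512) :
    177 / 100 ≤ (∫ z in Set.Ioo (-ρ) ρ, edens ε v z) ∨
    (∫ z in Set.Ioo (-ρ) ρ, ddens ε v z)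
      ≤ 6 * ((∫ z in Set.Ioo (-ρ) ρ, edens ε v z) - 4 / 3)
        + 6 * Real.exp (-(3 / 64 * ρ) / ε) := by
  obtain ⟨⟨p, hp, hvp⟩, ⟨n, hn, hvn⟩⟩ := good_points hρ hd hi ht
  have hIe := int_e hρ hd hi ε
  have hp1 : 0 < v p := by nlinarith
  have hn1 : v n < 0 := by nlinarith
  have hpp := phi_big hvp
  have hnn := phi_big hvn
  rw [phi_neg] at hnn
  have e0 : phi 0 = 0 := by simp [phi]
  obtain ⟨hp2, hp3⟩ := hp
  obtain ⟨hn2, hn3⟩ := hn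
  have hcont : ∀ x y, -ρ < x → y < ρ → ContinuousOn v (Set.Icc x y) := fun x y hx hy =>
    hd.continuousOn.mono fun z hz => ⟨hx.trans_le hz.1, hz.2.trans_lt hy⟩
  by_cases hA : ∀ z ∈ Set.Ico p ρ, 0 < v z
  swap
  · left
    push Not at hA
    obtain ⟨q', hq', hvq'⟩ := hA
    obtain ⟨q, hq, hvq⟩ := intermediate_value_Icc' hq'.1 (hcont p q' (by linarith) hq'.2)
      ⟨hvq', hp1.le⟩
    have hqρ : q < ρ := hq.2.trans_lt hq'.2
    have h1 := phi_le hρ hd hi hε (x := n) (y := p) (by linarith) (by linarith) (by linarith)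
    have h2 := phi_le hρ hd hi hε (x := p) (y := q) (by linarith) hq.1 hqρ
    have h3 := int_le hIe (edens_nonneg hε v) (x := n) (y := q) (by linarith)
      (by linarith [hq.1]) hqρ
    rw [← intervalIntegral.integral_add_adjacent_intervals
      (ivi hIe (x := n) (y := p) (by linarith) (by linarith) (by linarith))
      (ivi hIe (x := p) (y := q) (by linarith) hq.1 hqρ)] at h3
    rw [hvq, e0] at h2
    rw [abs_le] at h1 h2
    linarith
  by_cases hB : ∀ z ∈ Set.Ioc (-ρ) n, v z < 0
  swap
  · left
    push Not at hB
    obtain ⟨q', hq', hvq'⟩ := hB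
    obtain ⟨q, hq, hvq⟩ := intermediate_value_Icc' hq'.2 (hcont q' n hq'.1 (by linarith))
      ⟨hn1.le, hvq'⟩
    have hqρ : -ρ < q := hq'.1.trans_le hq.1
    have h1 := phi_le hρ hd hi hε (x := n) (y := p) (by linarith) (by linarith) (by linarith)
    have h2 := phi_le hρ hd hi hε (x := q) (y := n) hqρ hq.2 (by linarith)
    have h3 := int_le hIe (edens_nonneg hε v) (x := q) (y := p) hqρ
      (by linarith [hq.2]) (by linarith)
    rw [← intervalIntegral.integral_add_adjacent_intervals
      (ivi hIe (x := q) (y := n) hqρ hq.2 (by linarith))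
      (ivi hIe (x := n) (y := p) (by linarith) (by linarith) (by linarith))] at h3
    rw [hvq, e0] at h2
    rw [abs_le] at h1 h2
    linarith
  right
  have hnp : n ≤ p := by linarith
  have hc := hcont n p (by linarith) (by linarith)
  have hK : IsCompact (Set.Icc n p ∩ v ⁻¹' {0}) :=
    isCompact_Icc.of_isClosed_subset (hc.preimage_isClosed_of_isClosed isClosed_Icc
      isClosed_singleton) Set.inter_subset_left
  have hne : (Set.Icc n p ∩ v ⁻¹' {0}).Nonempty := by
    obtain ⟨q, hq, hvq⟩ := intermediate_value_Icc hnp hc ⟨hn1.le, hp1.le⟩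
    exact ⟨q, hq, hvq⟩
  obtain ⟨b, ⟨hbI, hb0⟩, hbmax⟩ := hK.exists_isGreatest hne
  obtain ⟨a, ⟨haI, ha0⟩, hamin⟩ := hK.exists_isLeast hne
  have hab : a ≤ b := hamin ⟨hbI, hb0⟩
  replace hb0 : v b = 0 := hb0
  replace ha0 : v a = 0 := ha0
  have hbpos : ∀ z, b < z → z < ρ → 0 ≤ v z := by
    intro z hbz hz
    rcases le_total p z with h | h
    · exact (hA z ⟨h, hz⟩).le
    · by_contra! hneg
      obtain ⟨q, hq, hvq⟩ := intermediate_value_Icc h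
        (hcont z p (by linarith [hbI.1]) (by linarith)) ⟨hneg.le, hp1.le⟩
      have := hbmax ⟨⟨by linarith [hbI.1, hq.1], hq.2⟩, hvq⟩
      linarith [hq.1]
  have haneg : ∀ z, -ρ < z → z < a → v z ≤ 0 := by
    intro z hz hza
    rcases le_total z n with h | h
    · exact (hB z ⟨hz, h⟩).le
    · by_contra! hneg
      obtain ⟨q, hq, hvq⟩ := intermediate_value_Icc h
        (hcont n z (by linarith) (by linarith [haI.2])) ⟨hn1.le, hneg.le⟩
      have := hamin ⟨⟨hq.1, by linarith [haI.2, hq.2]⟩, hvq⟩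
      linarith [hq.2]
  have hexp : 8 * Real.exp (-(3 / 32 * ρ) / ε) ≤ 6 * Real.exp (-(3 / 64 * ρ) / ε) := by
    have h1 : Real.exp (-(3 / 32 * ρ) / ε)
        = Real.exp (-(3 / 64 * ρ) / ε) * Real.exp (-(3 / 64 * ρ) / ε) := by
      rw [← Real.exp_add]; congr 1; ring
    have h2 : Real.exp (-(3 / 64 * ρ) / ε) ≤ 1 / 2 := by
      rw [neg_div, Real.exp_neg, inv_eq_one_div]
      apply one_div_le_one_div_of_le (by norm_num)
      have h3 : 1 ≤ 3 / 64 * ρ / ε := by rw [le_div_iff₀ hε]; linarith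
      linarith [Real.add_one_le_exp (3 / 64 * ρ / ε)]
    rw [h1]
    nlinarith [Real.exp_pos (-(3 / 64 * ρ) / ε)]
  have main : ∀ r, 3 / 4 * ρ < r → r < ρ → ∫ z in (-r)..r, ddens ε v z
      ≤ 6 * ((∫ z in Set.Ioo (-ρ) ρ, edens ε v z) - 4 / 3)
        + 6 * Real.exp (-(3 / 64 * ρ) / ε) := by
    intro r hr1 hr2
    have hbr : b ≤ r := by linarith [hbI.2]
    have har : -r ≤ a := by linarith [haI.1]
    have hbρ : -ρ < b := by linarith [hbI.1]
    have haρ : a < ρ := by linarith [haI.2]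
    have R := right_half hρ hd hi hε hbρ hbr hr2 hb0
      (fun z hz => hbpos z hz.1 (hz.2.trans hr2))
    have L := left_half hρ hd hi hε haρ har hr2 ha0
      (fun z hz => haneg z (by linarith [hz.1]) hz.2)
    have hmono : ∀ t, ρ / 4 ≤ t → Real.exp (-(3 / 8 / ε) * t) ≤ Real.exp (-(3 / 32 * ρ) / ε) := by
      intro t ht
      rw [Real.exp_le_exp]
      have : -(3 / 32 * ρ) / ε = -(3 / 8 / ε) * (ρ / 4) := by ring
      rw [this]
      have : (3 / 8 / ε) * (ρ / 4) ≤ (3 / 8 / ε) * t := by gcongr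
      linarith
    have hE1 := hmono (r - b) (by linarith [hbI.2])
    have hE2 := hmono (r + a) (by linarith [haI.1])
    have hmid : 0 ≤ ∫ z in a..b, edens ε v z :=
      intervalIntegral.integral_nonneg hab fun z _ => edens_nonneg hε v z
    have i1 := ivi hIe (x := -r) (y := a) (by linarith) har haρ
    have i2 := ivi hIe (x := a) (y := b) (by linarith) hab (by linarith)
    have i3 := ivi hIe (x := b) (y := r) hbρ hbr hr2
    have s1 := intervalIntegral.integral_add_adjacent_intervals i1 i2
    have s2 := intervalIntegral.integral_add_adjacent_intervals (i1.trans i2) i3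
    have tot := int_le hIe (edens_nonneg hε v) (x := -r) (y := r) (by linarith) (by linarith) hr2
    have hrr : -r ≤ r := by linarith
    have hID := int_D hρ hd hi hε
    have P := ftc_le (g := fun z => phi (v z))
      (φ := fun z => edens ε v z - 1 / 2 * ddens ε v z) hrr
      (fun z hz => hasDerivAt_phi (diffAt hd (by linarith [hz.1]) (by linarith [hz.2])))
      ((II hIe (by linarith) hrr hr2).sub ((II hID (by linarith) hrr hr2).const_mul (1 / 2)))
      (fun z _ => by rw [ddens_eq hε]; linarith)
    rw [intervalIntegral.integral_sub (ivi hIe (by linarith) hrr hr2)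
      ((ivi hID (by linarith) hrr hr2).const_mul _), intervalIntegral.integral_const_mul] at P
    linarith
  have hcov : AECover (volume.restrict (Set.Ioo (-ρ) ρ)) (nhdsWithin ρ (Set.Iio ρ))
      (fun r => Set.Ioc (-r) r) := by
    refine aecover_Ioo_of_Ioc ?_ ?_
    · exact (continuous_neg.tendsto ρ).mono_left nhdsWithin_le_nhds
    · exact Filter.tendsto_id.mono_left nhdsWithin_le_nhds
  have hlim := hcov.integral_tendsto_of_countably_generated (int_D hρ hd hi hε)
  refine le_of_tendsto hlim ?_
  have hev : ∀ᶠ r in nhdsWithin ρ (Set.Iio ρ), r ∈ Set.Ioo (3 / 4 * ρ) ρ :=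
    Ioo_mem_nhdsLT (by linarith)
  filter_upwards [hev] with r hr
  have := main r hr.1 hr.2
  rw [intervalIntegral.integral_of_le (by linarith [hr.1])] at this
  rw [Measure.restrict_restrict measurableSet_Ioc, Set.inter_eq_left.2]
  · exact this
  · exact fun z hz => ⟨by linarith [hz.1, hr.2], by linarith [hz.2, hr.2]⟩

end

/-- There exist positive constants `c₁, c₂` (depending only on `ρ`) and
`C, c > 0` such that for all sufficiently small `ε > 0` and every `v ∈ H¹(I)`:
(i) if `θ₂(v) ≤ c₂` then `∫_I ((ε/2)v′² + (1/(2ε))(v²−1)²) − c₀ ≥ −C·e^{−c/ε}`; and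
(ii) if in addition `θ₁(v) ≤ c₁`, then
`∫_I (√ε·v′ − (1−v²)/√ε)² ≤ C·[∫_I ((ε/2)v′² + (1/(2ε))(v²−1)²) − c₀] + C·e^{−c/ε}
  ≤ C·θ₁(v) + C·e^{−c/ε}`. -/
theorem energy_coercivity (ρ : ℝ) (hρ : 0 < ρ) :
    ∃ c₁ > 0, ∃ c₂ > 0, ∃ C > 0, ∃ c > 0, ∃ ε₀ > 0, ∀ ε : ℝ, 0 < ε → ε < ε₀ →
      ∀ v : ℝ → ℝ,
        DifferentiableOn ℝ v (Set.Ioo (-ρ) ρ) →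
        IntegrableOn (fun z => (v z) ^ 2 + (deriv v z) ^ 2) (Set.Ioo (-ρ) ρ) →
        (theta2 ρ v ≤ c₂ →
          ((∫ z in Set.Ioo (-ρ) ρ,
              ((ε / 2) * (deriv v z) ^ 2 + (1 / (2 * ε)) * ((v z) ^ 2 - 1) ^ 2)) - 4 / 3
            ≥ -(C * Real.exp (-c / ε)))) ∧
        (theta2 ρ v ≤ c₂ → theta1 ρ ε v ≤ c₁ →
          ((∫ z in Set.Ioo (-ρ) ρ,
              (Real.sqrt ε * deriv v z - (1 - (v z) ^ 2) / Real.sqrt ε) ^ 2)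
            ≤ C * ((∫ z in Set.Ioo (-ρ) ρ,
                ((ε / 2) * (deriv v z) ^ 2 + (1 / (2 * ε)) * ((v z) ^ 2 - 1) ^ 2)) - 4 / 3)
              + C * Real.exp (-c / ε) ∧
           C * ((∫ z in Set.Ioo (-ρ) ρ,
                ((ε / 2) * (deriv v z) ^ 2 + (1 / (2 * ε)) * ((v z) ^ 2 - 1) ^ 2)) - 4 / 3)
              + C * Real.exp (-c / ε)
            ≤ C * theta1 ρ ε v + C * Real.exp (-c / ε))) := by
  refine ⟨1 / 4, by norm_num, ρ ^ 2 / 512, by positivity, 6, by norm_num, 3 / 64 * ρ,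
    by positivity, 3 / 64 * ρ, by positivity, ?_⟩
  intro ε hε hε' v hd hi
  have hIe := int_e hρ hd hi ε
  have hexp := Real.exp_pos (-(3 / 64 * ρ) / ε)
  have hth : (∫ z in Set.Ioo (-ρ) ρ, edens ε v z) - 4 / 3 ≤ theta1 ρ ε v := by
    have hI1 : IntegrableOn (fun z => (1 + z ^ 2) * edens ε v z) (Set.Ioo (-ρ) ρ) := by
      refine Integrable.mono' (hIe.const_mul (1 + ρ ^ 2))
        ((by fun_prop : Continuous fun z : ℝ => 1 + z ^ 2).aestronglyMeasurable.mul
          hIe.aestronglyMeasurable) ?_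
      refine (ae_restrict_iff' measurableSet_Ioo).2 (Filter.Eventually.of_forall fun z hz => ?_)
      have h0 := edens_nonneg hε v z
      have h1 : z ^ 2 ≤ ρ ^ 2 := by nlinarith [hz.1, hz.2]
      rw [Real.norm_eq_abs, abs_of_nonneg (by positivity)]
      gcongr
    have : (∫ z in Set.Ioo (-ρ) ρ, edens ε v z)
        ≤ ∫ z in Set.Ioo (-ρ) ρ, (1 + z ^ 2) * edens ε v z := by
      refine integral_mono hIe hI1 fun z => ?_
      have h0 := edens_nonneg hε v z
      simp only
      nlinarith [mul_nonneg (sq_nonneg z) h0]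
    exact sub_le_sub_right this _
  change (theta2 ρ v ≤ ρ ^ 2 / 512 → (∫ z in Set.Ioo (-ρ) ρ, edens ε v z) - 4 / 3
      ≥ -(6 * Real.exp (-(3 / 64 * ρ) / ε))) ∧
    (theta2 ρ v ≤ ρ ^ 2 / 512 → theta1 ρ ε v ≤ 1 / 4 →
      ((∫ z in Set.Ioo (-ρ) ρ, ddens ε v z)
        ≤ 6 * ((∫ z in Set.Ioo (-ρ) ρ, edens ε v z) - 4 / 3)
          + 6 * Real.exp (-(3 / 64 * ρ) / ε) ∧
       6 * ((∫ z in Set.Ioo (-ρ) ρ, edens ε v z) - 4 / 3)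
          + 6 * Real.exp (-(3 / 64 * ρ) / ε)
        ≤ 6 * theta1 ρ ε v + 6 * Real.exp (-(3 / 64 * ρ) / ε)))
  have hD0 : 0 ≤ ∫ z in Set.Ioo (-ρ) ρ, ddens ε v z :=
    integral_nonneg fun z => sq_nonneg _
  refine ⟨fun ht => ?_, fun ht h1 => ⟨?_, by linarith⟩⟩
  · rcases dichotomy hρ hd hi hε hε' ht with h | h <;> linarith
  · rcases dichotomy hρ hd hi hε hε' ht with h | h
    · linarith
    · exact h
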